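/- Let 𝒜 = (I, (A_a)_{a∈Σ}, F) be a minimal uniformly convergent WFA whose ω-function f_𝒜 is not identically zero. Then there exists a nonzero row vector I_c such that I_c A_a = I_c for every a ∈ Σ (i.e., the matrices A_a have a common left eigenvector with eigenvalue 1). -/

import Mathlib

open Filter Topology Matrix

/-- The prefix of length `k` of an infinite word `w`. -/
def pref {A : Type*} (w : ℕ → A) (k : ℕ) : List A := (List.range k).map w

/-- The product `A_{v₁} ⋯ A_{v_k}` of matrices along a finite word `v`. -/
def wordProd {A : Type*} {n : ℕ} (M : A → Matrix (Fin n) (Fin n) ℝ) (v : List A) :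
    Matrix (Fin n) (Fin n) ℝ := (v.map M).prod

/-- The word function of the WFA `(I, M, F)`: `v ↦ I A_v F`. -/
def wfaWord {A : Type*} {n : ℕ} (I : Fin n → ℝ) (M : A → Matrix (Fin n) (Fin n) ℝ)
    (F : Fin n → ℝ) (v : List A) : ℝ := I ⬝ᵥ (wordProd M v) *ᵥ F

/-- The WFA with `n` states is left minimal: the row vectors `I A_u` span `ℝⁿ`. -/
def LeftMinimal {A : Type*} {n : ℕ} (I : Fin n → ℝ)
    (M : A → Matrix (Fin n) (Fin n) ℝ) : Prop :=
  Submodule.span ℝ {x : Fin n → ℝ | ∃ u : List A, x = I ᵥ* (wordProd M u)} = ⊤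

/-- The WFA with `n` states is right minimal: the column vectors `A_u F` span `ℝⁿ`. -/
def RightMinimal {A : Type*} {n : ℕ} (M : A → Matrix (Fin n) (Fin n) ℝ)
    (F : Fin n → ℝ) : Prop :=
  Submodule.span ℝ {x : Fin n → ℝ | ∃ u : List A, x = (wordProd M u) *ᵥ F} = ⊤

/-- A word function `F : Σ* → ℝ` is uniformly convergent with ω-function `f`. -/
def UnifConv {A : Type*} (F : List A → ℝ) (f : (ℕ → A) → ℝ) : Prop :=
  (∀ w : ℕ → A, Tendsto (fun k => F (pref w k)) atTop (𝓝 (f w))) ∧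
  ∀ ε > (0 : ℝ), ∃ k₀ : ℕ, ∀ w : ℕ → A, ∀ k > k₀, |F (pref w k) - f w| < ε

/-- Every finite continuation of a prefix of `w` is the prefix of some infinite word that
agrees with `w` up to that prefix. -/
lemma exists_pref_eq_append {A : Type*} (w : ℕ → A) (k : ℕ) (v : List A) :
    ∃ w' : ℕ → A, pref w' k = pref w k ∧ pref w' (k + v.length) = pref w k ++ v := by
  refine ⟨fun i => if i < k then w i else v.getD (i - k) (w i), ?_, ?_⟩
  · refine List.map_congr_left fun i hi => ?_
    simp [List.mem_range.1 hi]
  · refine List.ext_getElem (by simp [pref]) fun i h₁ h₂ => ?_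
    have hi : i < k + v.length := by simpa [pref] using h₁
    by_cases hik : i < k
    · simp [pref, hik]
    · have : i - k < v.length := by omega
      simp [pref, List.getElem_append, hik, this]

/-- For a uniformly convergent word function, inserting a fixed continuation after longer and
longer prefixes changes the values less and less. -/
lemma UnifConv.tendsto_append_sub {A : Type*} {G : List A → ℝ} {f : (ℕ → A) → ℝ}
    (h : UnifConv G f) (w : ℕ → A) (v : List A) :
    Tendsto (fun k => G (pref w k ++ v) - G (pref w k)) atTop (𝓝 0) := by
  rw [Metric.tendsto_atTop]
  intro ε hε
  obtain ⟨k₀, hk₀⟩ := h.2 (ε / 2) (half_pos hε)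
  refine ⟨k₀ + 1, fun k hk => ?_⟩
  obtain ⟨w', h₁, h₂⟩ := exists_pref_eq_append w k v
  have b₁ := hk₀ w' k (by omega)
  have b₂ := hk₀ w' (k + v.length) (by omega)
  rw [h₁, abs_lt] at b₁
  rw [h₂, abs_lt] at b₂
  rw [Real.dist_eq, sub_zero, abs_lt]
  constructor <;> linarith [b₁.1, b₁.2, b₂.1, b₂.2]

lemma wordProd_append {A : Type*} {n : ℕ} (M : A → Matrix (Fin n) (Fin n) ℝ) (u v : List A) :
    wordProd M (u ++ v) = wordProd M u * wordProd M v := by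
  simp [wordProd]

lemma wordProd_cons {A : Type*} {n : ℕ} (M : A → Matrix (Fin n) (Fin n) ℝ) (a : A)
    (v : List A) : wordProd M (a :: v) = M a * wordProd M v := by
  simp [wordProd]

/-- If `F` lies in the span of the differences `A_v F - F`, the ω-function of a uniformly
convergent WFA vanishes. -/
lemma UnifConv.eq_zero_of_mem_span {A : Type*} {n : ℕ} {I : Fin n → ℝ}
    {M : A → Matrix (Fin n) (Fin n) ℝ} {F : Fin n → ℝ} {f : (ℕ → A) → ℝ}
    (h : UnifConv (wfaWord I M F) f)
    (hF : F ∈ Submodule.span ℝ (Set.range fun v : List A => wordProd M v *ᵥ F - F))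
    (w : ℕ → A) : f w = 0 := by
  refine tendsto_nhds_unique (h.1 w) ?_
  change Tendsto (fun k => I ⬝ᵥ (wordProd M (pref w k)) *ᵥ F) atTop (𝓝 0)
  refine Submodule.span_induction
    (p := fun x _ => Tendsto (fun k => I ⬝ᵥ (wordProd M (pref w k)) *ᵥ x) atTop (𝓝 0))
    ?_ ?_ ?_ ?_ hF
  · rintro _ ⟨v, rfl⟩
    refine (h.tendsto_append_sub w v).congr fun k => ?_
    simp [wfaWord, wordProd_append, mulVec_sub, dotProduct_sub, mulVec_mulVec]
  · simp
  · intro x y _ _ hx hy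
    simpa [mulVec_add, dotProduct_add] using hx.add hy
  · intro c x _ hx
    simpa [mulVec_smul, dotProduct_smul] using hx.const_mul c

/-- Let `𝒜 = (I, (A_a), F)` be a minimal, uniformly convergent WFA whose ω-function is
not identically zero.  Then there exists a nonzero row vector `I_c` with `I_c A_a = I_c`
for every letter `a` (a common left 1-eigenvector of the transition matrices). -/
theorem common_left_eigenvector
    {A : Type*} [Fintype A] [Nonempty A]
    {n : ℕ} (I : Fin n → ℝ) (M : A → Matrix (Fin n) (Fin n) ℝ) (F : Fin n → ℝ)
    (hl : LeftMinimal I M) (hr : RightMinimal M F)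
    (f : (ℕ → A) → ℝ) (hA : UnifConv (wfaWord I M F) f)
    (hne : ∃ w : ℕ → A, f w ≠ 0) :
    ∃ Ic : Fin n → ℝ, Ic ≠ 0 ∧ ∀ a : A, Ic ᵥ* M a = Ic := by
  obtain ⟨w, hw⟩ := hne
  have hF : F ∉ Submodule.span ℝ (Set.range fun v : List A => wordProd M v *ᵥ F - F) :=
    fun hF => hw (hA.eq_zero_of_mem_span hF w)
  obtain ⟨φ, hφF, hφ⟩ := Submodule.exists_le_ker_of_notMem hF
  obtain ⟨Ic, rfl⟩ := (dotProductEquiv ℝ (Fin n)).surjective φ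
  have hconst : ∀ v : List A, Ic ⬝ᵥ wordProd M v *ᵥ F = Ic ⬝ᵥ F := fun v => by
    have := hφ (Submodule.subset_span ⟨v, rfl⟩)
    simpa [dotProduct_sub, sub_eq_zero] using this
  refine ⟨Ic, fun h0 => hφF (by simp [h0]), fun a => ?_⟩
  refine (dotProductEquiv ℝ (Fin n)).injective (LinearMap.ext_on hr ?_)
  rintro _ ⟨v, rfl⟩
  have := hconst (a :: v)
  rw [wordProd_cons, ← mulVec_mulVec, dotProduct_mulVec] at this
  simpa [hconst v] using this
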